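/- arXiv:1107.5510 — 12 statements merged into one kernel-verified Lean document; each statement's English description precedes it below -/
import Mathlib

section
/- Let G be a group and f, g : G → G group endomorphisms with f ∘ g = g ∘ f. For positive integers m ∣ n define the boosting function ι_{m,n} : G → G by ι_{m,n}(α) := ∏_{ℓ=0}^{n/m − 1} g^{n−(ℓ+1)m}(f^{ℓm}(α)), the product taken in order of increasing ℓ. Then for all α, γ ∈ G one has ι_{m,n}( g^m(γ) · α · (f^m(γ))⁻¹ ) = g^n(γ) · ι_{m,n}(α) · (f^n(γ))⁻¹. (Consequently ι_{m,n} is well defined on doubly-twisted conjugacy (Reidemeister) classes.) -/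
open Function

/-- The `m` to `n` level coincidence boosting function
`ι_{m,n}(α) = ∏_{ℓ=0}^{n/m − 1} g^{n−(ℓ+1)m}(f^{ℓm}(α))`, the product taken in
order of increasing `ℓ`. -/
def iotaBoost {G : Type*} [Group G] (f g : G →* G) (m n : ℕ) (α : G) : G :=
  ((List.range (n / m)).map fun ℓ => (⇑g)^[n - (ℓ + 1) * m] ((⇑f)^[ℓ * m] α)).prod

/-- Products whose factors differ by a twist `c ℓ * · * (c (ℓ + 1))⁻¹` telescope. -/
theorem List.prod_map_range_twist {G : Type*} [Group G] (a b c : ℕ → G) (k : ℕ)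
    (h : ∀ l < k, b l = c l * a l * (c (l + 1))⁻¹) :
    ((List.range k).map b).prod = c 0 * ((List.range k).map a).prod * (c k)⁻¹ := by
  induction k with
  | zero => simp
  | succ k ih =>
    rw [List.prod_range_succ, List.prod_range_succ, ih fun l hl => h l (by omega),
      h k (by omega)]
    group

/-- if `f` and `g` are commuting endomorphisms of a group `G` and `m ∣ n`
are positive integers, then
`ι_{m,n}(g^m(γ) · α · (f^m(γ))⁻¹) = g^n(γ) · ι_{m,n}(α) · (f^n(γ))⁻¹`,
so `ι_{m,n}` is well defined on doubly-twisted conjugacy classes. -/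
theorem iotaBoost_twisted_conjugate {G : Type*} [Group G] (f g : G →* G)
    (hcomm : ⇑f ∘ ⇑g = ⇑g ∘ ⇑f) (m n : ℕ) (hm : 0 < m) (hn : 0 < n) (hmn : m ∣ n)
    (α γ : G) :
    iotaBoost f g m n ((⇑g)^[m] γ * α * ((⇑f)^[m] γ)⁻¹) =
      (⇑g)^[n] γ * iotaBoost f g m n α * ((⇑f)^[n] γ)⁻¹ := by
  obtain ⟨k, rfl⟩ := hmn
  unfold iotaBoost
  rw [Nat.mul_div_cancel_left k hm]
  have hfg : Function.Commute (⇑f) (⇑g) := fun x => congrFun hcomm x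
  have key := List.prod_map_range_twist
    (fun l => (⇑g)^[m * k - (l + 1) * m] ((⇑f)^[l * m] α))
    (fun l => (⇑g)^[m * k - (l + 1) * m]
      ((⇑f)^[l * m] ((⇑g)^[m] γ * α * ((⇑f)^[m] γ)⁻¹)))
    (fun l => (⇑g)^[m * k - l * m] ((⇑f)^[l * m] γ)) k ?_
  · simpa [Nat.mul_comm k m] using key
  · intro l hl
    have hle : (l + 1) * m ≤ m * k := by
      rw [Nat.mul_comm m k]
      exact Nat.mul_le_mul_right m hl
    have hsub : m * k - l * m = m * k - (l + 1) * m + m := by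
      rw [Nat.add_mul] at hle ⊢
      omega
    have hadd : (l + 1) * m = l * m + m := by ring
    simp only [iterate_map_mul, iterate_map_inv]
    rw [(hfg.iterate_iterate (l * m) m).eq γ, ← Function.iterate_add_apply,
      ← Function.iterate_add_apply, ← hsub, ← hadd]
end

section
/- (On the nose boosting.) Let G be a group and f, g : G → G group endomorphisms with f ∘ g = g ∘ f, and let m ∣ n be positive integers. Suppose β, α ∈ G are such that ι_{m,n}(β) is doubly-twisted conjugate to α at level n. Then for every σ ∈ G that is doubly-twisted conjugate to α at level n, there exists τ ∈ G doubly-twisted conjugate to β at level m with ι_{m,n}(τ) = σ. -/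
open Function

/-- `σ'` is doubly-twisted conjugate to `σ` at level `r` if
`σ' = g^r(γ) · σ · (f^r(γ))⁻¹` for some `γ`. -/
def TwistedConj {G : Type*} [Group G] (f g : G →* G) (r : ℕ) (σ σ' : G) : Prop :=
  ∃ γ : G, σ' = (⇑g)^[r] γ * σ * ((⇑f)^[r] γ)⁻¹

theorem List.prod_map_range_telescope {G : Type*} [Group G] (c a : ℕ → G) (k : ℕ) :
    ((List.range k).map fun i => c i * a i * (c (i + 1))⁻¹).prod =
      c 0 * ((List.range k).map a).prod * (c k)⁻¹ := by
  induction k with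
  | zero => simp
  | succ k ih =>
    simp only [List.range_succ, List.map_append, List.map_cons, List.map_nil, List.prod_append,
      List.prod_cons, List.prod_nil, mul_one, ih]
    group

theorem TwistedConj.trans {G : Type*} [Group G] {f g : G →* G} {r : ℕ} {x y z : G}
    (hxy : TwistedConj f g r x y) (hyz : TwistedConj f g r y z) : TwistedConj f g r x z := by
  obtain ⟨γ, rfl⟩ := hxy
  obtain ⟨δ, rfl⟩ := hyz
  exact ⟨δ * γ, by simp only [iterate_map_mul, mul_inv_rev, mul_assoc]⟩

/-- Boosting carries twisted conjugation by `γ` at level `m` to twisted conjugation by `γ`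
at level `n`. -/
theorem iotaBoost_twisted {G : Type*} [Group G] {f g : G →* G} (hcomm : Function.Commute f g)
    {m n : ℕ} (hmn : m ∣ n) (β γ : G) :
    iotaBoost f g m n ((⇑g)^[m] γ * β * ((⇑f)^[m] γ)⁻¹) =
      (⇑g)^[n] γ * iotaBoost f g m n β * ((⇑f)^[n] γ)⁻¹ := by
  have telescope := List.prod_map_range_telescope
    (fun l => (⇑g)^[n - l * m] ((⇑f)^[l * m] γ))
    (fun l => (⇑g)^[n - (l + 1) * m] ((⇑f)^[l * m] β)) (n / m)
  simp only [Nat.div_mul_cancel hmn, zero_mul, Nat.sub_zero, Nat.sub_self, iterate_zero,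
    id_eq] at telescope
  rw [iotaBoost, iotaBoost, ← telescope]
  congr 1
  refine List.map_congr_left fun l hl => ?_
  have hle : (l + 1) * m ≤ n :=
    (Nat.mul_le_mul_right m (List.mem_range.mp hl)).trans (Nat.div_mul_le_self n m)
  have hsub : n - l * m = n - (l + 1) * m + m := by
    rw [Nat.succ_mul] at hle ⊢
    omega
  simp only [iterate_map_mul, iterate_map_inv]
  rw [(hcomm.iterate_iterate (l * m) m).eq γ, ← iterate_add_apply, ← iterate_add_apply, ← hsub,
    Nat.succ_mul]

/-- On the nose boosting: if `ι_{m,n}(β)` is doubly-twisted conjugate to `α`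
at level `n`, then every `σ` doubly-twisted conjugate to `α` at level `n` is of the form
`ι_{m,n}(τ)` for some `τ` doubly-twisted conjugate to `β` at level `m`. -/
theorem on_the_nose_boosting {G : Type*} [Group G] (f g : G →* G)
    (hcomm : ⇑f ∘ ⇑g = ⇑g ∘ ⇑f) (m n : ℕ) (hm : 0 < m) (hn : 0 < n) (hmn : m ∣ n)
    (β α : G) (hβα : TwistedConj f g n (iotaBoost f g m n β) α) :
    ∀ σ : G, TwistedConj f g n α σ →
      ∃ τ : G, TwistedConj f g m β τ ∧ iotaBoost f g m n τ = σ := by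
  intro σ hσ
  obtain ⟨γ, rfl⟩ := hβα.trans hσ
  exact ⟨_, ⟨γ, rfl⟩, iotaBoost_twisted (congrFun hcomm) hmn β γ⟩
end

section
/- Let G be a group and f, g : G → G group endomorphisms with f ∘ g = g ∘ f. Let k ∣ m ∣ n be positive integers. Then the boosting functions satisfy ι_{k,n} = ι_{m,n} ∘ ι_{k,m} as functions G → G, i.e. ι_{m,n}(ι_{k,m}(α)) = ι_{k,n}(α) for every α ∈ G. -/
open Function

theorem List.prod_map_range_mul {M : Type*} [Monoid M] (h : ℕ → M) (a b : ℕ) :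
    ((List.range (b * a)).map h).prod =
      ((List.range b).map fun i => ((List.range a).map fun j => h (i * a + j)).prod).prod := by
  induction b with
  | zero => simp
  | succ b ih =>
    rw [Nat.succ_mul, List.range_add, List.range_succ]
    simp [ih, Function.comp_def]

theorem MonoidHom.iterate_map_list_prod {M : Type*} [Monoid M] (f : M →* M) (r : ℕ)
    (l : List M) : (⇑f)^[r] l.prod = (l.map (⇑f)^[r]).prod := by
  induction r generalizing l with
  | zero => simp
  | succ r ih => rw [Function.iterate_succ_apply, map_list_prod, ih, List.map_map]; rfl

/-- for commuting endomorphisms `f`, `g` of a group and positive integers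
`k ∣ m ∣ n`, the boosting functions satisfy `ι_{k,n} = ι_{m,n} ∘ ι_{k,m}`. -/
theorem iotaBoost_comp {G : Type*} [Group G] (f g : G →* G)
    (hcomm : ⇑f ∘ ⇑g = ⇑g ∘ ⇑f) (k m n : ℕ) (hk : 0 < k) (hm : 0 < m) (hn : 0 < n)
    (hkm : k ∣ m) (hmn : m ∣ n) :
    ∀ α : G, iotaBoost f g m n (iotaBoost f g k m α) = iotaBoost f g k n α := by
  intro α
  obtain ⟨a, rfl⟩ := hkm
  obtain ⟨b, rfl⟩ := hmn
  have hdiv : k * a * b / k = b * a := by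
    rw [mul_assoc, Nat.mul_div_cancel_left _ hk, mul_comm]
  unfold iotaBoost
  rw [Nat.mul_div_cancel_left _ hm, Nat.mul_div_cancel_left _ hk, hdiv,
    List.prod_map_range_mul]
  congr 1
  refine List.map_congr_left fun i hi => ?_
  rw [MonoidHom.iterate_map_list_prod, MonoidHom.iterate_map_list_prod, List.map_map,
    List.map_map]
  congr 1
  refine List.map_congr_left fun j hj => ?_
  rw [List.mem_range] at hi hj
  have hfg : Function.Commute ⇑f ⇑g := fun x => congrFun hcomm x
  have hf : i * (k * a) + j * k = (i * a + j) * k := by ring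
  have hg : k * a * b - (i + 1) * (k * a) + (k * a - (j + 1) * k) =
      k * a * b - (i * a + j + 1) * k := by
    have hib : (i + 1) * (k * a) ≤ k * a * b := by
      rw [mul_comm]
      exact Nat.mul_le_mul_left _ hi
    have hja : (j + 1) * k ≤ k * a := by
      rw [mul_comm]
      exact Nat.mul_le_mul_left _ hj
    have hsum : (i * a + j + 1) * k + k * a = (i + 1) * (k * a) + (j + 1) * k := by ring
    omega
  simp only [Function.comp_apply]
  rw [(hfg.iterate_iterate (i * (k * a)) (k * a - (j + 1) * k)).eq,
    ← Function.iterate_add_apply, ← Function.iterate_add_apply, hf, hg]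
end

section
/- Let A be an abelian (additive) group and f, g : A → A commuting additive endomorphisms (f ∘ g = g ∘ f). Let m ∣ n be positive integers and define the boosting endomorphism ι_{m,n} := Σ_{ℓ=0}^{n/m − 1} g^{n−(ℓ+1)m} ∘ f^{ℓm}. Suppose that the endomorphism g^n − f^n is injective. Then for every β ∈ A, if ι_{m,n}(β) lies in the image of g^n − f^n, then β lies in the image of g^m − f^m. (In particular, the pair f, g is injective on essential boosts to level n whenever Coin(f^n, g^n) = ker(g^n − f^n) = 0.) -/
open Function

/-- The additive `m` to `n` level boosting function
`ι_{m,n}(α) = Σ_{ℓ=0}^{n/m − 1} g^{n−(ℓ+1)m}(f^{ℓm}(α))`. -/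
def iotaAdd {A : Type*} [AddCommGroup A] (f g : A →+ A) (m n : ℕ) (α : A) : A :=
  ∑ ℓ ∈ Finset.range (n / m), (⇑g)^[n - (ℓ + 1) * m] ((⇑f)^[ℓ * m] α)

/-- For commuting endomorphisms, the boosting function is a two-variable geometric sum in the
endomorphism ring. -/
theorem iotaAdd_mul_eq_geom_sum {A : Type*} [AddCommGroup A] (F G : AddMonoid.End A)
    (h : Commute F G) {m : ℕ} (hm : 0 < m) (k : ℕ) (α : A) :
    iotaAdd F G m (m * k) α =
      (∑ i ∈ Finset.range k, (F ^ m) ^ i * (G ^ m) ^ (k - 1 - i) : AddMonoid.End A) α := by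
  unfold iotaAdd
  rw [Nat.mul_div_cancel_left k hm]
  refine Eq.trans (Finset.sum_congr rfl fun i _ => ?_)
    (AddMonoidHom.finsetSum_apply
      (fun i => (F ^ m) ^ i * (G ^ m) ^ (k - 1 - i)) (Finset.range k) α).symm
  have hexp : m * k - (i + 1) * m = m * (k - 1 - i) := by
    rw [mul_comm (i + 1) m, ← Nat.mul_sub, Nat.sub_sub, Nat.add_comm 1 i]
  rw [← pow_mul, ← pow_mul, (h.pow_pow _ _).eq, hexp, mul_comm i m]
  change _ = (G ^ (m * (k - 1 - i))) ((F ^ (m * i)) α)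
  rw [AddMonoid.End.coe_pow, AddMonoid.End.coe_pow]
  rfl

/-- for commuting additive endomorphisms `f, g` of an abelian group and
positive `m ∣ n`, if `g^n − f^n` is injective, then whenever `ι_{m,n}(β)` lies in the
image of `g^n − f^n`, already `β` lies in the image of `g^m − f^m`. -/
theorem iotaAdd_mem_image_of_injective {A : Type*} [AddCommGroup A] (f g : A →+ A)
    (hcomm : ⇑f ∘ ⇑g = ⇑g ∘ ⇑f) (m n : ℕ) (hm : 0 < m) (hn : 0 < n) (hmn : m ∣ n)
    (hinj : Function.Injective fun a => (⇑g)^[n] a - (⇑f)^[n] a) :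
    ∀ β : A, (∃ γ : A, (⇑g)^[n] γ - (⇑f)^[n] γ = iotaAdd f g m n β) →
      ∃ γ : A, (⇑g)^[m] γ - (⇑f)^[m] γ = β := by
  rintro β ⟨γ, hγ⟩
  obtain ⟨k, rfl⟩ := hmn
  let F : AddMonoid.End A := f
  let G : AddMonoid.End A := g
  have hFG : Commute F G := AddMonoidHom.ext fun a => congrFun hcomm a
  have hpow : Commute (F ^ m) (G ^ m) := hFG.pow_pow m m
  set S : AddMonoid.End A := ∑ i ∈ Finset.range k, (F ^ m) ^ i * (G ^ m) ^ (k - 1 - i) with hS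
  have hleft : (G ^ m - F ^ m) * S = G ^ (m * k) - F ^ (m * k) := by
    rw [hS, hpow.mul_neg_geom_sum₂, pow_mul, pow_mul]
  have hright : S * (G ^ m - F ^ m) = G ^ (m * k) - F ^ (m * k) := by
    rw [← neg_sub (F ^ m), mul_neg, hS, hpow.geom_sum₂_mul, neg_sub, pow_mul, pow_mul]
  have hdiff (j : ℕ) (a : A) : (G ^ j - F ^ j) a = (⇑g)^[j] a - (⇑f)^[j] a := by
    change (G ^ j) a - (F ^ j) a = _
    rw [AddMonoid.End.coe_pow, AddMonoid.End.coe_pow]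
    rfl
  have hSinj : Function.Injective S := by
    refine Function.Injective.of_comp (f := ⇑(G ^ m - F ^ m)) ?_
    rw [← AddMonoid.End.coe_mul, hleft]
    exact fun a b hab => hinj (by simpa only [hdiff] using hab)
  refine ⟨γ, hSinj ?_⟩
  rw [← hdiff]
  change (S * (G ^ m - F ^ m)) γ = S β
  rw [hright, hdiff, hγ]
  exact iotaAdd_mul_eq_geom_sum F G hFG hm k β
end

section
/- Let A be an abelian (additive) group and f, g : A → A commuting additive endomorphisms (f ∘ g = g ∘ f), with g bijective. Let k, m be coprime positive integers and n = k·m. Suppose α, β, γ ∈ A satisfy ι_{k,n}(β) = α and ι_{m,n}(γ) = α. Then there exists δ ∈ A with ι_{1,n}(δ) = α; moreover, if ι_{k,n} is injective then ι_{1,k}(δ) = β, and if ι_{m,n} is injective then ι_{1,m}(δ) = γ. (This is the algebraic core of the theorem that a commuting pair with g invertible on the fundamental group, injective on essential boosts and coincidence essentially reducible, is coincidence essentially reducible to the gcd.) -/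
open Function

section Boosting

universe u

open Finset
open scoped IsMulCommutative

variable {R : Type*} [CommRing R]

/-- The boosting element `∑ ℓ < n / m, G ^ (n - (ℓ + 1) * m) * F ^ (ℓ * m)`. -/
def boost (F G : R) (m n : ℕ) : R :=
  ∑ ℓ ∈ range (n / m), G ^ (n - (ℓ + 1) * m) * F ^ (ℓ * m)

theorem boost_one_add (F G : R) (m d : ℕ) :
    boost F G 1 (d + m) = F ^ d * boost F G 1 m + G ^ m * boost F G 1 d := by
  simp only [boost, Nat.div_one, mul_one, sum_range_add, mul_sum]
  rw [add_comm]
  congr 1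
  · refine sum_congr rfl fun i _ => ?_
    rw [show d + m - (d + i + 1) = m - (i + 1) by lia, pow_add]
    ring
  · refine sum_congr rfl fun i hi => ?_
    have := mem_range.mp hi
    rw [show d + m - (i + 1) = m + (d - (i + 1)) by lia, pow_add]
    ring

theorem boost_mul_boost_one (F G : R) {k : ℕ} (hk : 0 < k) (m : ℕ) :
    boost F G k (m * k) * boost F G 1 k = boost F G 1 (m * k) := by
  induction m with
  | zero => simp [boost]
  | succ m ih =>
    have h : boost F G k ((m + 1) * k) = F ^ (m * k) + G ^ k * boost F G k (m * k) := by
      simp only [boost, Nat.mul_div_cancel _ hk, sum_range_succ, mul_sum]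
      rw [add_comm]
      congr 1
      · simp
      · refine sum_congr rfl fun i hi => ?_
        have h' : (i + 1) * k ≤ m * k := Nat.mul_le_mul_right k (mem_range.mp hi)
        rw [show (m + 1) * k - (i + 1) * k = k + (m * k - (i + 1) * k) by
          rw [add_mul m]; lia, pow_add, mul_assoc]
    rw [h, add_mul m 1 k, one_mul, boost_one_add, ← ih]
    ring

theorem isCoprime_boost_one (F : R) {G : R} (hG : IsUnit G) {k m : ℕ} (h : Nat.Coprime k m) :
    IsCoprime (boost F G 1 k) (boost F G 1 m) := by
  induction hs : k + m using Nat.strong_induction_on generalizing k m with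
  | _ s ih =>
    wlog hle : k ≤ m generalizing k m
    · exact (this h.symm (by lia) (by lia)).symm
    obtain ⟨d, rfl⟩ := Nat.exists_eq_add_of_le' hle
    rcases Nat.eq_zero_or_pos k with rfl | hk
    · obtain rfl : d = 1 := by simpa using h
      simp [boost, isCoprime_one_right]
    · rw [boost_one_add, add_comm, IsCoprime.add_mul_right_right_iff,
        isCoprime_mul_unit_left_right (hG.pow k)]
      exact ih (k + d) (by lia) (by simpa using h) rfl

theorem exists_smul_eq_of_isCoprime {A : Type*} [AddCommGroup A] [Module R A]
    {a b p q N : R} (hab : IsCoprime a b) (hp : p * a = N) (hq : q * b = N)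
    {α β γ : A} (hβ : p • β = α) (hγ : q • γ = α) : ∃ δ : A, N • δ = α := by
  obtain ⟨u, v, huv⟩ := hab
  refine ⟨u • β + v • γ, ?_⟩
  calc N • (u • β + v • γ) = (u * a) • p • β + (v * b) • q • γ := by
        rw [smul_add, smul_smul, smul_smul, smul_smul, smul_smul]
        congr 2
        · rw [← hp]; ring
        · rw [← hq]; ring
    _ = α := by rw [hβ, hγ, ← add_smul, huv, one_smul]

theorem boost_smul_eq_iotaAdd {A : Type*} [AddCommGroup A] [Module R A] {f g : A →+ A} {F G : R}
    (hF : ∀ x : A, F • x = f x) (hG : ∀ x : A, G • x = g x) (m n : ℕ) (x : A) :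
    boost F G m n • x = iotaAdd f g m n x := by
  have hf : (⇑f) = (F • ·) := funext fun x => (hF x).symm
  have hg : (⇑g) = (G • ·) := funext fun x => (hG x).symm
  simp only [boost, iotaAdd, sum_smul, mul_smul, hf, hg, smul_iterate]

theorem exists_commRing_module_of_comp_comm {A : Type u} [AddCommGroup A] (f g : A →+ A)
    (hcomm : ⇑f ∘ ⇑g = ⇑g ∘ ⇑f) (hg : Function.Bijective g) :
    ∃ (R : Type u) (_ : CommRing R) (_ : Module R A) (F G : R), IsUnit G ∧
      (∀ x : A, F • x = f x) ∧ ∀ x : A, G • x = g x := by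
  let e := AddEquiv.ofBijective g hg
  let f₀ : AddMonoid.End A := f
  let g₀ : AddMonoid.End A := g
  let g₁ : AddMonoid.End A := e.symm.toAddMonoidHom
  have h₁ : g₀ * g₁ = 1 := AddMonoidHom.ext e.apply_symm_apply
  have h₂ : g₁ * g₀ = 1 := AddMonoidHom.ext e.symm_apply_apply
  have hfg : Commute f₀ g₀ := AddMonoidHom.ext fun x => congrFun hcomm x
  have hfg₁ : Commute f₀ g₁ := Commute.units_inv_right (u := ⟨g₀, g₁, h₁, h₂⟩) hfg
  have hgg₁ : Commute g₀ g₁ := h₁.trans h₂.symm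
  let s : Set (AddMonoid.End A) := {f₀, g₀, g₁}
  have hs : ∀ x ∈ s, ∀ y ∈ s, x * y = y * x := by
    rintro x (rfl | rfl | rfl) y (rfl | rfl | rfl)
    exacts [rfl, hfg, hfg₁, hfg.symm, rfl, hgg₁, hfg₁.symm, hgg₁.symm, rfl]
  have := Subring.isMulCommutative_closure hs
  let G : Subring.closure s := ⟨g₀, Subring.subset_closure (by simp [s])⟩
  let G₁ : Subring.closure s := ⟨g₁, Subring.subset_closure (by simp [s])⟩
  refine ⟨Subring.closure s, inferInstance, inferInstanceAs (Module (Subring.closure s) A),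
    ⟨f₀, Subring.subset_closure (by simp [s])⟩, G, ?_, fun _ => rfl, fun _ => rfl⟩
  exact IsUnit.of_mul_eq_one G₁ (Subtype.ext h₁)

end Boosting

/-- (algebraic core of reducibility to the gcd with `g` invertible).
If `f`, `g` are commuting additive endomorphisms of an abelian group with `g` bijective,
`k`, `m` coprime positive integers, `n = k·m`, and `ι_{k,n}(β) = α = ι_{m,n}(γ)`, then
there exists `δ` with `ι_{1,n}(δ) = α`; moreover `ι_{1,k}(δ) = β` if `ι_{k,n}` is
injective, and `ι_{1,m}(δ) = γ` if `ι_{m,n}` is injective. -/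
theorem iotaAdd_reduce_to_gcd {A : Type*} [AddCommGroup A] (f g : A →+ A)
    (hcomm : ⇑f ∘ ⇑g = ⇑g ∘ ⇑f) (hg : Function.Bijective g)
    (k m : ℕ) (hk : 0 < k) (hm : 0 < m) (hkm : Nat.Coprime k m) (n : ℕ) (hn : n = k * m)
    (α β γ : A) (hβ : iotaAdd f g k n β = α) (hγ : iotaAdd f g m n γ = α) :
    ∃ δ : A, iotaAdd f g 1 n δ = α ∧
      (Function.Injective (iotaAdd f g k n) → iotaAdd f g 1 k δ = β) ∧
      (Function.Injective (iotaAdd f g m n) → iotaAdd f g 1 m δ = γ) := by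
  obtain ⟨R, _, _, F, G, hGu, hF, hG⟩ := exists_commRing_module_of_comp_comm f g hcomm hg
  have hp : boost F G k n * boost F G 1 k = boost F G 1 n := by
    rw [hn, mul_comm k m, boost_mul_boost_one F G hk]
  have hq : boost F G m n * boost F G 1 m = boost F G 1 n := by
    rw [hn, boost_mul_boost_one F G hm]
  simp only [← boost_smul_eq_iotaAdd hF hG] at hβ hγ ⊢
  obtain ⟨δ, hδ⟩ := exists_smul_eq_of_isCoprime (isCoprime_boost_one F hGu hkm) hp hq hβ hγ
  refine ⟨δ, hδ, fun hinj => hinj ?_, fun hinj => hinj ?_⟩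
  · simp only [← boost_smul_eq_iotaAdd hF hG]
    rw [smul_smul, hp, hδ, hβ]
  · simp only [← boost_smul_eq_iotaAdd hF hG]
    rw [smul_smul, hq, hδ, hγ]
end

section
/- Let k and m be coprime positive integers and n = k·m. Then there exists a polynomial p(X) ∈ ℤ[X] satisfying simultaneously: σ_{k,n}(X) = p(X) · σ_{1,m}(X), σ_{m,n}(X) = p(X) · σ_{1,k}(X), and σ_{1,n}(X) = p(X) · σ_{1,k}(X) · σ_{1,m}(X). -/
open Polynomial

/-- The polynomial `σ_{p,q}(X) = Σ_{i=0}^{q/p − 1} X^{i·p} ∈ ℤ[X]`. -/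
noncomputable def sigmaPoly (p q : ℕ) : Polynomial ℤ :=
  ∑ i ∈ Finset.range (q / p), Polynomial.X ^ (i * p)

/-- Grouping the terms of a geometric sum of length `a * b` into blocks of length `a`. -/
theorem geom_sum_mul_geom_sum {R : Type*} [CommSemiring R] (x : R) (a b : ℕ) :
    (∑ i ∈ Finset.range b, x ^ (i * a)) * ∑ i ∈ Finset.range a, x ^ i =
      ∑ i ∈ Finset.range (a * b), x ^ i := by
  induction b with
  | zero => simp
  | succ b ih =>
    rw [Finset.sum_range_succ, add_mul, ih, Nat.mul_succ, Finset.sum_range_add, Finset.mul_sum]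
    simp only [pow_add, mul_comm b a]

theorem geom_sum_dvd_geom_sum_mul {R : Type*} [CommSemiring R] (x : R) (a b : ℕ) :
    ∑ i ∈ Finset.range a, x ^ i ∣ ∑ i ∈ Finset.range (a * b), x ^ i :=
  Dvd.intro_left _ (geom_sum_mul_geom_sum x a b)

theorem isCoprime_geom_sum {R : Type*} [CommRing R] (x : R) {a b : ℕ} (h : a.Coprime b) :
    IsCoprime (∑ i ∈ Finset.range a, x ^ i) (∑ i ∈ Finset.range b, x ^ i) := by
  rcases Nat.lt_trichotomy b 1 with hb | rfl | hb
  · obtain rfl : b = 0 := by omega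
    obtain rfl : a = 1 := by simpa using h
    simpa using isCoprime_one_left
  · simpa using isCoprime_one_right
  · obtain ⟨u, -, hu⟩ := Nat.exists_mul_mod_eq_one_of_coprime h hb
    have huv : a * u = b * (a * u / b) + 1 := by
      conv_lhs => rw [← Nat.div_add_mod (a * u) b, hu]
    obtain ⟨s, hs⟩ := geom_sum_dvd_geom_sum_mul x a u
    obtain ⟨t, ht⟩ := geom_sum_dvd_geom_sum_mul x b (a * u / b)
    rw [huv, geom_sum_succ, ht] at hs
    exact ⟨s, -(x * t), by linear_combination -hs⟩

theorem sigmaPoly_one (q : ℕ) : sigmaPoly 1 q = ∑ i ∈ Finset.range q, X ^ i := by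
  simp [sigmaPoly]

theorem sigmaPoly_one_ne_zero {q : ℕ} (hq : 0 < q) : sigmaPoly 1 q ≠ 0 := by
  rw [sigmaPoly_one]
  exact (monic_geom_sum_X hq.ne').ne_zero

theorem sigmaPoly_mul_sigmaPoly_one {a : ℕ} (ha : 0 < a) (b : ℕ) :
    sigmaPoly a (a * b) * sigmaPoly 1 a = sigmaPoly 1 (a * b) := by
  rw [sigmaPoly_one, sigmaPoly_one, sigmaPoly, Nat.mul_div_cancel_left b ha,
    geom_sum_mul_geom_sum]

/-- for coprime positive integers `k`, `m` and `n = k·m`, there is a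
polynomial `p(X) ∈ ℤ[X]` with `σ_{k,n} = p·σ_{1,m}`, `σ_{m,n} = p·σ_{1,k}` and
`σ_{1,n} = p·σ_{1,k}·σ_{1,m}`. -/
theorem sigmaPoly_factorization (k m : ℕ) (hk : 0 < k) (hm : 0 < m)
    (hkm : Nat.Coprime k m) (n : ℕ) (hn : n = k * m) :
    ∃ p : Polynomial ℤ,
      sigmaPoly k n = p * sigmaPoly 1 m ∧
      sigmaPoly m n = p * sigmaPoly 1 k ∧
      sigmaPoly 1 n = p * sigmaPoly 1 k * sigmaPoly 1 m := by
  subst hn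
  have h₁ := sigmaPoly_mul_sigmaPoly_one hk m
  have h₂ := sigmaPoly_mul_sigmaPoly_one hm k
  rw [mul_comm m k] at h₂
  have hcop : IsCoprime (sigmaPoly 1 k) (sigmaPoly 1 m) := by
    simpa only [sigmaPoly_one] using isCoprime_geom_sum X hkm
  obtain ⟨p, hp⟩ := hcop.mul_dvd (Dvd.intro_left _ h₁) (Dvd.intro_left _ h₂)
  refine ⟨p, mul_right_cancel₀ (sigmaPoly_one_ne_zero hk) ?_,
    mul_right_cancel₀ (sigmaPoly_one_ne_zero hm) ?_, ?_⟩
  · rw [h₁, hp]; ring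
  · rw [h₂, hp]; ring
  · rw [hp]; ring
end

section
/- Let a, b be integers, let k and m be coprime positive integers, and let n = k·m. Assume ι_{1,n}(a,b) ≠ 0. Then lcm(ι_{m,n}(a,b), ι_{k,n}(a,b)) = |ι_{1,n}(a,b)| if and only if gcd(ι_{1,k}(a,b), ι_{1,m}(a,b)) = 1 (where lcm and gcd of integers are taken to be nonnegative). -/
/-- The integer `ι_{p,q}(a,b) = Σ_{ℓ=0}^{q/p − 1} b^{q−(ℓ+1)p} · a^{ℓ·p}`. -/
def iotaInt (a b : ℤ) (p q : ℕ) : ℤ :=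
  ∑ ℓ ∈ Finset.range (q / p), b ^ (q - (ℓ + 1) * p) * a ^ (ℓ * p)

theorem iotaInt_mul_right (a b : ℤ) {p : ℕ} (hp : 0 < p) (j : ℕ) :
    iotaInt a b p (j * p) =
      ∑ ℓ ∈ Finset.range j, (b ^ p) ^ (j - 1 - ℓ) * (a ^ p) ^ ℓ := by
  unfold iotaInt
  rw [Nat.mul_div_cancel _ hp]
  refine Finset.sum_congr rfl fun ℓ _ => ?_
  rw [← Nat.sub_mul, ← pow_mul, ← pow_mul, mul_comm p, mul_comm p, Nat.sub_sub, add_comm 1]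

theorem iotaInt_succ_mul (a b : ℤ) {p : ℕ} (hp : 0 < p) (j : ℕ) :
    iotaInt a b p ((j + 1) * p) = b ^ p * iotaInt a b p (j * p) + a ^ (j * p) := by
  rw [iotaInt_mul_right a b hp, iotaInt_mul_right a b hp, Finset.sum_range_succ, Finset.mul_sum]
  congr 1
  · refine Finset.sum_congr rfl fun ℓ hℓ => ?_
    have h : j + 1 - 1 - ℓ = (j - 1 - ℓ) + 1 := by
      have := Finset.mem_range.mp hℓ
      omega
    rw [h, pow_succ]
    ring
  · simp [← pow_mul, mul_comm]

theorem iotaInt_zero_right (a b : ℤ) (p : ℕ) : iotaInt a b p 0 = 0 := by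
  simp [iotaInt]

theorem iotaInt_one_add (a b : ℤ) (i j : ℕ) :
    iotaInt a b 1 (i + j) = b ^ j * iotaInt a b 1 i + a ^ i * iotaInt a b 1 j := by
  have hs (r : ℕ) : iotaInt a b 1 (r + 1) = b * iotaInt a b 1 r + a ^ r := by
    simpa using iotaInt_succ_mul a b one_pos r
  induction j with
  | zero => simp [iotaInt_zero_right]
  | succ j ih =>
    rw [← add_assoc, hs, hs, ih]
    ring

theorem iotaInt_mul_iotaInt_one (a b : ℤ) {p : ℕ} (hp : 0 < p) (j : ℕ) :
    iotaInt a b p (j * p) * iotaInt a b 1 p = iotaInt a b 1 (j * p) := by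
  induction j with
  | zero => simp [iotaInt_zero_right]
  | succ j ih =>
    rw [iotaInt_succ_mul a b hp, Nat.succ_mul, iotaInt_one_add, ← ih]
    ring

/-- The lcm of two complementary divisors of `N` is complementary to the gcd of the others. -/
theorem Nat.lcm_mul_gcd_of_mul_eq {x y u v N : ℕ} (hN : N ≠ 0) (hx : x * v = N)
    (hy : y * u = N) : Nat.lcm x y * Nat.gcd u v = N := by
  have hx0 : 0 < x := Nat.pos_of_ne_zero (by rintro rfl; simp at hx; exact hN hx.symm)
  apply Nat.eq_of_mul_eq_mul_left (Nat.gcd_pos_of_pos_left y hx0)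
  rw [← mul_assoc, Nat.gcd_mul_lcm, ← Nat.gcd_mul_left, mul_assoc, hy, mul_comm x y, mul_assoc,
    hx, Nat.gcd_mul_right]

/-- for integers `a`, `b`, coprime positive integers `k`, `m` and `n = k·m`,
assuming `ι_{1,n}(a,b) ≠ 0`, we have `lcm(ι_{m,n}, ι_{k,n}) = |ι_{1,n}|` if and only if
`gcd(ι_{1,k}, ι_{1,m}) = 1`. -/
theorem iotaInt_lcm_iff_gcd (a b : ℤ) (k m : ℕ) (hk : 0 < k) (hm : 0 < m)
    (hkm : Nat.Coprime k m) (n : ℕ) (hn : n = k * m)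
    (h1n : iotaInt a b 1 n ≠ 0) :
    Int.lcm (iotaInt a b m n) (iotaInt a b k n) = (iotaInt a b 1 n).natAbs ↔
      Int.gcd (iotaInt a b 1 k) (iotaInt a b 1 m) = 1 := by
  have hX : iotaInt a b m n * iotaInt a b 1 m = iotaInt a b 1 n := by
    rw [hn, iotaInt_mul_iotaInt_one a b hm]
  have hY : iotaInt a b k n * iotaInt a b 1 k = iotaInt a b 1 n := by
    rw [hn, mul_comm k m, iotaInt_mul_iotaInt_one a b hk]
  have hN := Int.natAbs_ne_zero.mpr h1n
  have key : Int.lcm (iotaInt a b m n) (iotaInt a b k n) *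
      Int.gcd (iotaInt a b 1 k) (iotaInt a b 1 m) = (iotaInt a b 1 n).natAbs :=
    Nat.lcm_mul_gcd_of_mul_eq hN (by rw [← Int.natAbs_mul, hX]) (by rw [← Int.natAbs_mul, hY])
  constructor
  · intro h
    rw [h] at key
    exact (Nat.mul_eq_left hN).mp key
  · intro h
    rwa [h, mul_one] at key
end

section
/- Let a, b be integers, let k and m be coprime positive integers, let n = k·m, and set N := |b^n − a^n|, assumed nonzero. In the cyclic group ℤ/Nℤ, the intersection of the subgroup generated by the residue of ι_{m,n}(a,b) with the subgroup generated by the residue of ι_{k,n}(a,b) equals the subgroup generated by the residue of ι_{1,n}(a,b) if and only if gcd(ι_{1,k}(a,b), ι_{1,m}(a,b)) = 1. -/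
/-- The telescoping identity `ι_{p,q}(a,b) (b^p - a^p) = b^q - a^q`. -/
theorem iotaInt_mul_pow_sub_pow (a b : ℤ) {p q : ℕ} (hp : 0 < p) (hpq : p ∣ q) :
    iotaInt a b p q * (b ^ p - a ^ p) = b ^ q - a ^ q := by
  obtain ⟨r, rfl⟩ := hpq
  have hsum : iotaInt a b p (p * r) =
      ∑ i ∈ Finset.range r, (a ^ p) ^ i * (b ^ p) ^ (r - 1 - i) := by
    rw [iotaInt, Nat.mul_div_cancel_left r hp]
    refine Finset.sum_congr rfl fun i _ => ?_
    rw [← pow_mul, ← pow_mul, mul_comm, mul_comm i p, mul_comm (i + 1) p, ← Nat.mul_sub,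
      Nat.sub_sub, add_comm 1 i]
  have h := geom_sum₂_mul (a ^ p) (b ^ p) r
  rw [← hsum, ← pow_mul, ← pow_mul] at h
  linarith

/-- The residue of `x` lies in the subgroup generated by the residue of a divisor `u` of the
modulus exactly when `u` divides `x`. -/
theorem ZMod.intCast_mem_zmultiples_intCast_iff_dvd {N : ℕ} {u : ℤ} (hu : u ∣ N) (x : ℤ) :
    (x : ZMod N) ∈ AddSubgroup.zmultiples (u : ZMod N) ↔ u ∣ x := by
  rw [AddSubgroup.mem_zmultiples_iff]
  constructor
  · rintro ⟨c, hc⟩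
    rw [zsmul_eq_mul, ← Int.cast_mul, ZMod.intCast_eq_intCast_iff_dvd_sub] at hc
    exact (dvd_sub_left (dvd_mul_left u c)).mp (hu.trans hc)
  · rintro ⟨c, rfl⟩
    exact ⟨c, by rw [zsmul_eq_mul, ← Int.cast_mul, mul_comm]⟩

theorem ZMod.zmultiples_inf_eq_zmultiples_iff {N : ℕ} {u v w : ℤ} (hu : u ∣ N) (hv : v ∣ N)
    (hw : w ∣ N) :
    AddSubgroup.zmultiples (u : ZMod N) ⊓ AddSubgroup.zmultiples (v : ZMod N) =
        AddSubgroup.zmultiples (w : ZMod N) ↔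
      ∀ x : ℤ, u ∣ x ∧ v ∣ x ↔ w ∣ x := by
  rw [AddSubgroup.ext_iff, ZMod.intCast_surjective.forall]
  simp only [AddSubgroup.mem_inf, ZMod.intCast_mem_zmultiples_intCast_iff_dvd, hu, hv, hw]

/-- A nonzero common multiple `w = u * t = v * s` is a least common multiple of `u` and `v`
if and only if its cofactors `s` and `t` are coprime. -/
theorem Int.forall_dvd_and_dvd_iff_dvd_iff_gcd_eq_one {u v w s t : ℤ} (hw : w ≠ 0)
    (hut : w = u * t) (hvs : w = v * s) :
    (∀ x : ℤ, u ∣ x ∧ v ∣ x ↔ w ∣ x) ↔ Int.gcd s t = 1 := by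
  constructor
  · intro h
    obtain ⟨s', hs'⟩ := Int.gcd_dvd_left s t
    obtain ⟨t', ht'⟩ := Int.gcd_dvd_right s t
    set g : ℤ := (Int.gcd s t : ℤ)
    have hwu : w = g * (u * t') := by rw [hut, ht']; ring
    have hwv : w = g * (v * s') := by rw [hvs, hs']; ring
    have hg0 : g ≠ 0 := left_ne_zero_of_mul (hwu ▸ hw)
    have hx0 : u * t' ≠ 0 := right_ne_zero_of_mul (hwu ▸ hw)
    have hx : u * t' = v * s' := mul_left_cancel₀ hg0 (hwu.symm.trans hwv)
    have hdvd : g * (u * t') ∣ 1 * (u * t') := by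
      rw [one_mul, ← hwu]
      exact (h _).mp ⟨dvd_mul_right u t', hx ▸ dvd_mul_right v s'⟩
    have hg1 : g ∣ 1 := (mul_dvd_mul_iff_right hx0).mp hdvd
    exact Nat.dvd_one.mp (Int.natCast_dvd_natCast.mp hg1)
  · intro h x
    constructor
    · rintro ⟨⟨y, hy⟩, ⟨z, hz⟩⟩
      obtain ⟨p, q, hpq⟩ := Int.isCoprime_iff_gcd_eq_one.mpr h
      refine ⟨p * z + q * y, ?_⟩
      calc x = p * (s * x) + q * (t * x) := by linear_combination -x * hpq
        _ = p * (s * (v * z)) + q * (t * (u * y)) := by rw [← hy, ← hz]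
        _ = w * (p * z + q * y) := by
          linear_combination -(p * z) * hvs - (q * y) * hut
    · intro hwx
      exact ⟨(Dvd.intro t hut.symm).trans hwx, (Dvd.intro s hvs.symm).trans hwx⟩

/-- for integers `a`, `b`, coprime positive integers `k`, `m`, `n = k·m`
and `N = |b^n − a^n| ≠ 0`, in `ℤ/Nℤ` the intersection of the cyclic subgroups generated
by the residues of `ι_{m,n}` and `ι_{k,n}` equals the cyclic subgroup generated by the
residue of `ι_{1,n}` if and only if `gcd(ι_{1,k}, ι_{1,m}) = 1`. -/
theorem iotaInt_subgroup_inter_iff_gcd (a b : ℤ) (k m : ℕ) (hk : 0 < k) (hm : 0 < m)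
    (hkm : Nat.Coprime k m) (n : ℕ) (hn : n = k * m)
    (N : ℕ) (hN : N = (b ^ n - a ^ n).natAbs) (hN0 : N ≠ 0) :
    (AddSubgroup.zmultiples ((iotaInt a b m n : ZMod N)) ⊓
        AddSubgroup.zmultiples ((iotaInt a b k n : ZMod N)) =
      AddSubgroup.zmultiples ((iotaInt a b 1 n : ZMod N))) ↔
      Int.gcd (iotaInt a b 1 k) (iotaInt a b 1 m) = 1 := by
  have hD0 : b ^ n - a ^ n ≠ 0 := by
    rwa [hN, Int.natAbs_ne_zero] at hN0
  have dvd_modulus {p : ℕ} (hp : 0 < p) (hpn : p ∣ n) : iotaInt a b p n ∣ (N : ℤ) := by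
    rw [hN, Int.dvd_natAbs]
    exact Dvd.intro _ (iotaInt_mul_pow_sub_pow a b hp hpn)
  have eq_mul {p : ℕ} (hp : 0 < p) (hpn : p ∣ n) :
      iotaInt a b 1 n = iotaInt a b p n * iotaInt a b 1 p := by
    have hn1 := iotaInt_mul_pow_sub_pow a b one_pos (one_dvd n)
    have hpq := iotaInt_mul_pow_sub_pow a b hp hpn
    have hp1 := iotaInt_mul_pow_sub_pow a b one_pos (one_dvd p)
    have h0 : b ^ 1 - a ^ 1 ≠ 0 := right_ne_zero_of_mul (hn1 ▸ hD0)
    refine mul_right_cancel₀ h0 ?_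
    rw [mul_assoc, hp1, hpq, hn1]
  have hkn : k ∣ n := hn ▸ dvd_mul_right k m
  have hmn : m ∣ n := hn ▸ dvd_mul_left m k
  have hι0 : iotaInt a b 1 n ≠ 0 :=
    left_ne_zero_of_mul (iotaInt_mul_pow_sub_pow a b one_pos (one_dvd n) ▸ hD0)
  rw [ZMod.zmultiples_inf_eq_zmultiples_iff (dvd_modulus hm hmn) (dvd_modulus hk hkn)
    (dvd_modulus one_pos (one_dvd n))]
  exact Int.forall_dvd_and_dvd_iff_dvd_iff_gcd_eq_one hι0 (eq_mul hm hmn) (eq_mul hk hkn)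
end

section
/- Let a, b be integers with gcd(a,b) = 1, and let k, m be positive integers with gcd(k,m) = 1. Then gcd( Σ_{ℓ=0}^{k−1} b^{k−1−ℓ} a^{ℓ} , Σ_{ℓ=0}^{m−1} b^{m−1−ℓ} a^{ℓ} ) = 1. -/
theorem geom_sum₂_add {R : Type*} [CommSemiring R] (a b : R) (k n : ℕ) :
    ∑ ℓ ∈ Finset.range (k + n), b ^ (k + n - 1 - ℓ) * a ^ ℓ =
      b ^ n * ∑ ℓ ∈ Finset.range k, b ^ (k - 1 - ℓ) * a ^ ℓ +
        a ^ k * ∑ ℓ ∈ Finset.range n, b ^ (n - 1 - ℓ) * a ^ ℓ := by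
  rw [Finset.sum_range_add, Finset.mul_sum, Finset.mul_sum]
  congr 1
  · refine Finset.sum_congr rfl fun ℓ hℓ => ?_
    have hℓ := Finset.mem_range.mp hℓ
    rw [show k + n - 1 - ℓ = n + (k - 1 - ℓ) by omega, pow_add, mul_assoc]
  · refine Finset.sum_congr rfl fun ℓ _ => ?_
    rw [show k + n - 1 - (k + ℓ) = n - 1 - ℓ by omega, pow_add, mul_left_comm]

theorem IsCoprime.geom_sum₂_left {R : Type*} [CommRing R] {a b : R} (hab : IsCoprime a b)
    {k : ℕ} (hk : 0 < k) :
    IsCoprime (∑ ℓ ∈ Finset.range k, b ^ (k - 1 - ℓ) * a ^ ℓ) a := by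
  obtain ⟨n, rfl⟩ := Nat.exists_eq_add_of_le hk
  rw [geom_sum₂_add]
  simpa using (hab.symm.pow_left (m := n)).add_mul_left_left
    (∑ ℓ ∈ Finset.range n, b ^ (n - 1 - ℓ) * a ^ ℓ)

theorem IsCoprime.geom_sum₂ {R : Type*} [CommRing R] {a b : R} (hab : IsCoprime a b)
    {k m : ℕ} (hkm : k.Coprime m) :
    IsCoprime (∑ ℓ ∈ Finset.range k, b ^ (k - 1 - ℓ) * a ^ ℓ)
      (∑ ℓ ∈ Finset.range m, b ^ (m - 1 - ℓ) * a ^ ℓ) := by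
  induction h : k + m using Nat.strong_induction_on generalizing k m with
  | _ s ih =>
    wlog hle : k ≤ m generalizing k m
    · exact (this hkm.symm (by omega) (by omega)).symm
    rcases Nat.eq_zero_or_pos k with rfl | hk
    · obtain rfl : m = 1 := by simpa using hkm
      simpa using isCoprime_one_right
    · obtain ⟨n, rfl⟩ := Nat.exists_eq_add_of_le hle
      have hkn : k.Coprime n := by simpa using hkm
      rw [geom_sum₂_add a b k n, add_comm, mul_comm (b ^ n)]
      exact ((hab.geom_sum₂_left hk).pow_right.mul_right
        (ih (k + n) (by omega) hkn rfl)).add_mul_left_right _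

/-- if `gcd(a,b) = 1` and `gcd(k,m) = 1` with `k`, `m` positive, then
`gcd(Σ_{ℓ<k} b^{k−1−ℓ} a^ℓ, Σ_{ℓ<m} b^{m−1−ℓ} a^ℓ) = 1`. -/
theorem gcd_geom_sums_eq_one (a b : ℤ) (hab : Int.gcd a b = 1)
    (k m : ℕ) (hk : 0 < k) (hm : 0 < m) (hkm : Nat.Coprime k m) :
    Int.gcd (∑ ℓ ∈ Finset.range k, b ^ (k - 1 - ℓ) * a ^ ℓ)
      (∑ ℓ ∈ Finset.range m, b ^ (m - 1 - ℓ) * a ^ ℓ) = 1 := by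
  exact Int.isCoprime_iff_gcd_eq_one.mp ((Int.isCoprime_iff_gcd_eq_one.mpr hab).geom_sum₂ hkm)
end

section
/- Let a, b be integers and let k, m be integers with k ≥ 2, m ≥ 2 and gcd(k,m) = 1. Then gcd( ι_{1,k}(a,b), ι_{1,m}(a,b) ) = 1 if and only if gcd(a,b) = 1. (This is the arithmetic content of the theorem that degree-a and degree-b self maps of the circle are coincidence essentially reducible to the gcd if and only if gcd(a,b) = 1.) -/
/-- The integer `ι_{1,k}(a,b) = Σ_{ℓ=0}^{k−1} b^{k−1−ℓ} · a^ℓ`. -/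
def iotaOne (a b : ℤ) (k : ℕ) : ℤ :=
  ∑ ℓ ∈ Finset.range k, b ^ (k - 1 - ℓ) * a ^ ℓ

@[simp]
theorem iotaOne_zero (a b : ℤ) : iotaOne a b 0 = 0 := by
  simp [iotaOne]

@[simp]
theorem iotaOne_one (a b : ℤ) : iotaOne a b 1 = 1 := by
  simp [iotaOne]

theorem iotaOne_succ (a b : ℤ) (n : ℕ) :
    iotaOne a b (n + 1) = b * iotaOne a b n + a ^ n := by
  rw [iotaOne, iotaOne, Finset.sum_range_succ, Finset.mul_sum]
  congr 1
  · refine Finset.sum_congr rfl fun i hi => ?_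
    have hi' : i < n := Finset.mem_range.mp hi
    rw [← mul_assoc, ← pow_succ', show n + 1 - 1 - i = n - 1 - i + 1 by omega]
  · simp

theorem iotaOne_add (a b : ℤ) (k n : ℕ) :
    iotaOne a b (k + n) = b ^ n * iotaOne a b k + a ^ k * iotaOne a b n := by
  induction n with
  | zero => simp
  | succ n ih =>
    rw [← add_assoc, iotaOne_succ, ih, iotaOne_succ]
    ring

theorem isCoprime_iotaOne_left {a b : ℤ} (h : IsCoprime a b) {k : ℕ} (hk : 0 < k) :
    IsCoprime (iotaOne a b k) a := by
  obtain ⟨n, rfl⟩ := Nat.exists_eq_add_of_le hk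
  rw [Nat.succ_eq_add_one, zero_add, iotaOne_add, iotaOne_one, mul_one, pow_one]
  exact (IsCoprime.add_mul_left_left_iff).mpr h.symm.pow_left

theorem isCoprime_iotaOne_add_right_iff {a b : ℤ} (h : IsCoprime a b) {k : ℕ} (hk : 0 < k)
    (n : ℕ) :
    IsCoprime (iotaOne a b k) (iotaOne a b (k + n)) ↔
      IsCoprime (iotaOne a b k) (iotaOne a b n) := by
  rw [iotaOne_add, IsCoprime.mul_add_right_right_iff, IsCoprime.mul_right_iff]
  exact and_iff_right (isCoprime_iotaOne_left h hk).pow_right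

theorem isCoprime_iotaOne {a b : ℤ} (h : IsCoprime a b) (k m : ℕ) (hkm : Nat.Coprime k m) :
    IsCoprime (iotaOne a b k) (iotaOne a b m) := by
  induction hs : k + m using Nat.strong_induction_on generalizing k m with
  | _ s ih =>
    wlog hle : k ≤ m generalizing k m
    · exact (this m k hkm.symm (by omega) (by omega)).symm
    rcases Nat.eq_zero_or_pos k with rfl | hk
    · obtain rfl : m = 1 := by simpa using hkm
      simpa using isCoprime_one_right
    · obtain ⟨n, rfl⟩ := Nat.exists_eq_add_of_le hle
      rw [isCoprime_iotaOne_add_right_iff h hk]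
      exact ih (k + n) (by omega) k n (by simpa using hkm) rfl

theorem dvd_iotaOne {a b d : ℤ} (ha : d ∣ a) (hb : d ∣ b) {k : ℕ} (hk : 2 ≤ k) :
    d ∣ iotaOne a b k := by
  obtain ⟨n, rfl⟩ := Nat.exists_eq_add_of_le' hk
  rw [← add_assoc n 1 1, iotaOne_succ]
  exact dvd_add (hb.mul_right _) (dvd_pow ha n.succ_ne_zero)

/-- for integers `a`, `b` and coprime integers `k, m ≥ 2`,
`gcd(ι_{1,k}(a,b), ι_{1,m}(a,b)) = 1` if and only if `gcd(a,b) = 1`. -/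
theorem iotaOne_gcd_one_iff (a b : ℤ) (k m : ℕ) (hk : 2 ≤ k) (hm : 2 ≤ m)
    (hkm : Nat.Coprime k m) :
    Int.gcd (iotaOne a b k) (iotaOne a b m) = 1 ↔ Int.gcd a b = 1 := by
  rw [← Int.isCoprime_iff_gcd_eq_one, ← Int.isCoprime_iff_gcd_eq_one]
  refine ⟨fun h => ?_, fun h => isCoprime_iotaOne h k m hkm⟩
  have ha : (Int.gcd a b : ℤ) ∣ a := Int.gcd_dvd_left a b
  have hb : (Int.gcd a b : ℤ) ∣ b := Int.gcd_dvd_right a b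
  have hu := h.isUnit_of_dvd' (dvd_iotaOne ha hb hk) (dvd_iotaOne ha hb hm)
  rw [Int.isCoprime_iff_gcd_eq_one]
  simpa [Int.isUnit_iff_natAbs_eq] using hu
end

section
/- Let k and m be coprime positive integers. Then the following two sets of positive integers are equal: R = { r : r > 0 and there exists c with c ∣ m, c ≠ 1 and lcm(r, k) = c·k } and S = { a·b : a ∣ m, b ∣ k and a ≠ 1 }. -/
/-- for coprime positive integers `k`, `m`, the set
`R = {r > 0 : ∃ c ∣ m, c ≠ 1, lcm(r,k) = c·k}` equals the set
`S = {a·b : a ∣ m, b ∣ k, a ≠ 1}`. -/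
theorem lcm_divisor_set_eq (k m : ℕ) (hk : 0 < k) (hm : 0 < m)
    (hkm : Nat.Coprime k m) :
    {r : ℕ | 0 < r ∧ ∃ c : ℕ, c ∣ m ∧ c ≠ 1 ∧ Nat.lcm r k = c * k} =
      {s : ℕ | ∃ a b : ℕ, a ∣ m ∧ b ∣ k ∧ a ≠ 1 ∧ s = a * b} := by
  ext r
  constructor
  · rintro ⟨-, c, hcm, hc, h⟩
    refine ⟨c, Nat.gcd r k, hcm, Nat.gcd_dvd_right r k, hc, ?_⟩
    have hmul := Nat.gcd_mul_lcm r k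
    rw [h] at hmul
    exact Nat.eq_of_mul_eq_mul_right hk (by linarith)
  · rintro ⟨a, b, ha, hb, ha1, rfl⟩
    have hb0 : 0 < b := Nat.pos_of_dvd_of_pos hb hk
    refine ⟨Nat.mul_pos (Nat.pos_of_dvd_of_pos ha hm) hb0, a, ha, ha1, ?_⟩
    have hgcd : Nat.gcd (a * b) k = b := by
      rw [Nat.Coprime.gcd_mul_left_cancel b (hkm.coprime_dvd_right ha).symm,
        Nat.gcd_eq_left hb]
    have hmul := Nat.gcd_mul_lcm (a * b) k
    rw [hgcd] at hmul
    exact Nat.eq_of_mul_eq_mul_left hb0 (by linarith)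
end

section
/- There exist real numbers q and ε with 0 < q < 1 and 0 < ε < 1 such that 8·q = q^(3ε) and 32·q = q^(5ε) + 1. (These numbers produce self maps f of degree 2 and g(x) = x^ε of degree 1 on the circle and a point that is a coincidence point of f^3, g^3 and of f^5, g^5 but not of f, g, showing that the sets P_3(f,g) and P_5(f,g) need not be disjoint.) -/
/-- there exist real numbers `q`, `ε` in `(0,1)` with `8q = q^(3ε)` and
`32q = q^(5ε) + 1` (producing a point on the circle lying in both `P_3(f,g)` and
`P_5(f,g)` for `f` of degree `2` and `g(x) = x^ε`). -/
theorem exists_q_eps_coincidence : ∃ q ε : ℝ, 0 < q ∧ q < 1 ∧ 0 < ε ∧ ε < 1 ∧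
    8 * q = q ^ (3 * ε) ∧ 32 * q = q ^ (5 * ε) + 1 := by
  obtain ⟨y, ⟨hy0, hy1⟩, hy⟩ : ∃ y ∈ Set.Ioo (0 : ℝ) 1, 4 * y ^ 3 - y ^ 5 = 1 :=
    intermediate_value_Ioo (f := fun y : ℝ => 4 * y ^ 3 - y ^ 5) zero_le_one
      (by fun_prop) (by norm_num)
  have hq0 : 0 < y ^ 3 / 8 := by positivity
  have hqy : y ^ 3 / 8 < y := by
    linarith [pow_le_of_le_one hy0.le hy1.le (three_ne_zero)]
  have hq1 : y ^ 3 / 8 < 1 := hqy.trans hy1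
  have hlq : Real.log (y ^ 3 / 8) < 0 := Real.log_neg hq0 hq1
  have hpow : (y ^ 3 / 8) ^ Real.logb (y ^ 3 / 8) y = y :=
    Real.rpow_logb hq0 hq1.ne hy0
  have hpow_nat (n : ℕ) : (y ^ 3 / 8) ^ ((n : ℝ) * Real.logb (y ^ 3 / 8) y) = y ^ n := by
    rw [mul_comm, Real.rpow_mul_natCast hq0.le, hpow]
  refine ⟨y ^ 3 / 8, Real.logb (y ^ 3 / 8) y, hq0, hq1,
    div_pos_of_neg_of_neg (Real.log_neg hy0 hy1) hlq,
    (div_lt_one_of_neg hlq).2 (Real.log_lt_log hq0 hqy), ?_, ?_⟩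
  · rw [show (3 : ℝ) = (3 : ℕ) by norm_num, hpow_nat]
    ring
  · rw [show (5 : ℝ) = (5 : ℕ) by norm_num, hpow_nat]
    linarith
end
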